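/- (Additivity violation of the regularized minimum output entropy.) Let N be an integer with N > e^{18}. For each k ∈ ℕ define: A_k = inf over unit vectors ξ ∈ ℓ²(F_∞^k) of H(Ĝ_k(ξ)), where Ĝ_k(ξ) is the N^{2k} × N^{2k} positive semidefinite matrix indexed by pairs of tuples (v,w), (v',w') ∈ {1,…,N}^k × {1,…,N}^k with entries Ĝ_k(ξ)_{(v,w),(v',w')} = N^{-2k}⟨U_{v'}V_{w'}ξ, U_v V_w ξ⟩; and B_k = inf over unit vectors ξ ∈ ℓ²(F_∞^k) of H(G_k(ξ)), where G_k(ξ) is the N^k × N^k matrix with entries G_k(ξ)_{v,w} = N^{-k}⟨U_w ξ, U_v ξ⟩. Then limsup_{k→∞} A_k / k < 2 · liminf_{k→∞} B_k / k. In particular H̄_min(Φ_{N,l} ∘ Φ_{N,r}) < H̄_min(Φ_{N,l}) + H̄_min(Φ_{N,r}), i.e. the regularized minimum output entropy is strictly subadditive for this pair of quantum channels with commuting systems of Kraus operators. -/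

import Mathlib

open scoped ENNReal
open Filter

noncomputable section

/-- The free group on countably many generators. -/
abbrev FG : Type := FreeGroup ℕ

/-- The generators `g_i` of the free group. -/
def gen (i : ℕ) : FG := FreeGroup.of i

/-- `ℓ²(F_∞^k)`. -/
abbrev l2 (k : ℕ) : Type := lp (fun _ : Fin k → FG => ℂ) 2

/-- The von Neumann entropy of a (Hermitian) matrix: `H(M) = −Σ_i λ_i log λ_i`, where
the `λ_i` are the eigenvalues of `M` (junk value `0` for non-Hermitian matrices). -/
def vnEntropy {n : Type*} [Fintype n] [DecidableEq n] (M : Matrix n n ℂ) : ℝ :=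
  if h : M.IsHermitian then ∑ i, Real.negMulLog (h.eigenvalues i) else 0

/-- The complementary-channel output of `(Φ_{N,l} ∘ Φ_{N,r})^{⊗k}` at `|ξ⟩⟨ξ|`: the
`N^{2k} × N^{2k}` matrix with entries
`Ĝ_k(ξ)_{(v,w),(v',w')} = N^{-2k}⟨U_{v'}V_{w'}ξ, U_vV_wξ⟩`, where
`(U_vV_wξ)(x) = ξ(g_{v_1}⁻¹ x_1 g_{w_1}, …, g_{v_k}⁻¹ x_k g_{w_k})`. -/
def GhatK (N k : ℕ) (ξ : l2 k) :
    Matrix ((Fin k → Fin N) × (Fin k → Fin N)) ((Fin k → Fin N) × (Fin k → Fin N)) ℂ :=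
  Matrix.of fun p q => ((N : ℂ) ^ (2 * k))⁻¹ *
    ∑' x : Fin k → FG,
      (starRingEnd ℂ) (ξ (fun j => (gen (q.1 j : ℕ))⁻¹ * x j * gen (q.2 j : ℕ))) *
        ξ (fun j => (gen (p.1 j : ℕ))⁻¹ * x j * gen (p.2 j : ℕ))

/-- The complementary-channel output of `Φ_{N,l}^{⊗k}` at `|ξ⟩⟨ξ|`: the matrix with
entries `G_k(ξ)_{vw} = N^{-k}⟨U_w ξ, U_v ξ⟩`, where
`(U_v ξ)(x) = ξ(g_{v_1}^{-1}x_1, …, g_{v_k}^{-1}x_k)`. -/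
def Gmat (N k : ℕ) (ξ : l2 k) : Matrix (Fin k → Fin N) (Fin k → Fin N) ℂ :=
  Matrix.of fun v w => ((N : ℂ) ^ k)⁻¹ *
    ∑' x : Fin k → FG,
      (starRingEnd ℂ) (ξ (fun j => (gen (w j : ℕ))⁻¹ * x j)) *
        ξ (fun j => (gen (v j : ℕ))⁻¹ * x j)

/-- `A_k = H_min((Φ_{N,l} ∘ Φ_{N,r})^{⊗k})`. -/
def A (N k : ℕ) : ℝ :=
  sInf {x : ℝ | ∃ ξ : l2 k, ‖ξ‖ = 1 ∧ x = vnEntropy (GhatK N k ξ)}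

/-- `B_k = H_min(Φ_{N,l}^{⊗k}) = H_min(Φ_{N,r}^{⊗k})`. -/
def B (N k : ℕ) : ℝ :=
  sInf {x : ℝ | ∃ ξ : l2 k, ‖ξ‖ = 1 ∧ x = vnEntropy (Gmat N k ξ)}

namespace Reindex

open scoped InnerProductSpace

variable {X : Type*}

lemma norm_add_three_sq_le (x y z : ℂ) :
    ‖x + y + z‖ ^ 2 ≤ 3 * (‖x‖ ^ 2 + ‖y‖ ^ 2 + ‖z‖ ^ 2) := by
  have h : ‖x + y + z‖ ≤ ‖x‖ + ‖y‖ + ‖z‖ := norm_add₃_le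
  have := pow_le_pow_left₀ (norm_nonneg _) h 2
  nlinarith [sq_nonneg (‖x‖ - ‖y‖), sq_nonneg (‖x‖ - ‖z‖), sq_nonneg (‖y‖ - ‖z‖)]

local notation "H" X => lp (fun _ : X => ℂ) 2

lemma memℓp_two_iff {f : X → ℂ} : Memℓp f 2 ↔ Summable fun x => ‖f x‖ ^ 2 := by
  rw [memℓp_gen_iff (by norm_num)]
  simp

lemma hasSum_norm_sq (ξ : H X) : HasSum (fun x => ‖ξ x‖ ^ 2) (‖ξ‖ ^ 2) := by
  simpa using lp.hasSum_norm (p := 2) (by norm_num) ξ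

/-- Precomposition of a square-summable function with a permutation. -/
def pull (e : Equiv.Perm X) : (H X) →ₗ[ℂ] (H X) where
  toFun ξ := ⟨fun x => ξ (e x), memℓp_two_iff.2 <|
    (memℓp_two_iff.1 (lp.memℓp ξ)).comp_injective e.injective⟩
  map_add' _ _ := rfl
  map_smul' _ _ := rfl

@[simp] lemma pull_apply (e : Equiv.Perm X) (ξ : H X) (x : X) : pull e ξ x = ξ (e x) := rfl

/-- Restriction of a square-summable function to a set. -/
def cut (S : Set X) : (H X) →ₗ[ℂ] (H X) where
  toFun ξ := ⟨S.indicator ξ, memℓp_two_iff.2 <| by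
    refine ((memℓp_two_iff.1 (lp.memℓp ξ)).indicator S).congr fun x => ?_
    by_cases hx : x ∈ S <;> simp [hx]⟩
  map_add' ξ η := Subtype.ext (Set.indicator_add' S ξ η)
  map_smul' c ξ := by ext x; by_cases hx : x ∈ S <;> simp [hx]

@[simp] lemma cut_apply (S : Set X) (ξ : H X) (x : X) : cut S ξ x = S.indicator ξ x := rfl

lemma cut_add_cut_compl (S : Set X) (ξ : H X) : cut S ξ + cut Sᶜ ξ = ξ := by
  ext x; by_cases hx : x ∈ S <;> simp [hx]

lemma pull_mul (e f : Equiv.Perm X) (ξ : H X) : pull (e * f) ξ = pull f (pull e ξ) := rfl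

lemma inner_pull_pull (e : Equiv.Perm X) (ξ η : H X) : ⟪pull e ξ, pull e η⟫_ℂ = ⟪ξ, η⟫_ℂ := by
  simp only [lp.inner_eq_tsum, pull_apply]
  exact e.tsum_eq fun x => ⟪ξ x, η x⟫_ℂ

lemma norm_pull (e : Equiv.Perm X) (ξ : H X) : ‖pull e ξ‖ = ‖ξ‖ := by
  rw [norm_eq_sqrt_re_inner (𝕜 := ℂ), inner_pull_pull, ← norm_eq_sqrt_re_inner]

lemma inner_pull_left (e : Equiv.Perm X) (ξ η : H X) :
    ⟪pull e ξ, η⟫_ℂ = ⟪ξ, pull e⁻¹ η⟫_ℂ := by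
  rw [← inner_pull_pull e ξ, ← pull_mul, inv_mul_cancel]; rfl

lemma inner_cut_left (S : Set X) (ξ η : H X) : ⟪cut S ξ, η⟫_ℂ = ⟪ξ, cut S η⟫_ℂ := by
  simp only [lp.inner_eq_tsum, cut_apply]
  refine tsum_congr fun x => ?_
  by_cases hx : x ∈ S <;> simp [hx]

lemma inner_cut_cut_of_disjoint {S S' : Set X} (h : Disjoint S S') (ξ η : H X) :
    ⟪cut S ξ, cut S' η⟫_ℂ = 0 := by
  simp only [lp.inner_eq_tsum, cut_apply]
  refine (tsum_congr fun x => ?_).trans tsum_zero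
  by_cases hx : x ∈ S
  · simp [Set.disjoint_left.1 h hx]
  · simp [hx]

lemma pull_cut (e : Equiv.Perm X) (S : Set X) (ξ : H X) :
    pull e (cut S ξ) = cut (e ⁻¹' S) (pull e ξ) := by
  ext x; by_cases hx : e x ∈ S <;> simp [hx]

lemma cut_pull (e : Equiv.Perm X) (S : Set X) (ξ : H X) :
    cut S (pull e ξ) = pull e (cut (e.symm ⁻¹' S) ξ) := by
  rw [pull_cut]; congr 1; ext x; simp

lemma sum_norm_sq_cut_le {ι : Type*} [Fintype ι] {S : ι → Set X}
    (hS : Pairwise (Function.onFun Disjoint S)) (ξ : H X) : ∑ i, ‖cut (S i) ξ‖ ^ 2 ≤ ‖ξ‖ ^ 2 := by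
  refine hasSum_le (fun x => ?_) (hasSum_sum fun i _ => hasSum_norm_sq (cut (S i) ξ))
    (hasSum_norm_sq ξ)
  by_cases hx : ∃ i, x ∈ S i
  · obtain ⟨i, hi⟩ := hx
    rw [Finset.sum_eq_single i]
    · simp [hi]
    · intro j _ hj
      have : x ∉ S j := Set.disjoint_left.1 (hS hj.symm) hi
      simp [this]
    · simp
  · push Not at hx
    simp only [cut_apply, Set.indicator_of_notMem (hx _)]
    simp

/-- The mixed Gram matrices of the translates `pull (T a) ξ` and `pull (T b) η` are bounded
in Hilbert–Schmidt norm. -/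
def GramBound {α : Type*} [Fintype α] (T : α → Equiv.Perm X) (C : ℝ) : Prop :=
  ∀ ξ η : H X, ∑ a, ∑ b, ‖⟪pull (T a) ξ, pull (T b) η⟫_ℂ‖ ^ 2 ≤ C * (‖ξ‖ ^ 2 * ‖η‖ ^ 2)

lemma GramBound.comp_equiv {α β : Type*} [Fintype α] [Fintype β] {T : α → Equiv.Perm X} {C : ℝ}
    (hT : GramBound T C) (f : β ≃ α) : GramBound (fun b => T (f b)) C := by
  intro ξ η
  refine le_of_eq_of_le ?_ (hT ξ η)
  rw [← f.sum_comp]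
  exact Finset.sum_congr rfl fun b _ =>
    f.sum_comp fun a => ‖⟪pull (T (f b)) ξ, pull (T a) η⟫_ℂ‖ ^ 2

section Step

variable {α ι : Type*} {T : α → Equiv.Perm X} {C : ℝ}
  {e : ι → Equiv.Perm X} {W : ι → Set X}

lemma inner_pull_cut_pull (hcomm : ∀ a i, T a * e i = e i * T a)
    (hW : ∀ a i, T a ⁻¹' W i = W i) (a b : α) (i : ι) (ξ ζ : H X) :
    ⟪pull (T a) (cut (W i) (pull (e i) ξ)), pull (T b) ζ⟫_ℂ
      = ⟪pull (T a) ξ, pull (T b) (pull (e i)⁻¹ (cut (W i) ζ))⟫_ℂ := by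
  have hinv : (e i)⁻¹ * T b = T b * (e i)⁻¹ := by
    rw [inv_mul_eq_iff_eq_mul, ← mul_assoc, ← hcomm, mul_inv_cancel_right]
  have hcut : cut (W i) (pull (T b) ζ) = pull (T b) (cut (W i) ζ) := by rw [pull_cut, hW]
  rw [pull_cut, hW, inner_cut_left, hcut, ← pull_mul, ← hcomm, pull_mul, inner_pull_left,
    ← pull_mul, ← pull_mul, hinv]

variable [Fintype α]

lemma GramBound.sum_cut_le (hT : GramBound T C) (hcomm : ∀ a i, T a * e i = e i * T a)
    (hW : ∀ a i, T a ⁻¹' W i = W i) (i : ι) (ξ ζ : H X) :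
    ∑ a, ∑ b, ‖⟪pull (T a) (cut (W i) (pull (e i) ξ)), pull (T b) ζ⟫_ℂ‖ ^ 2
      ≤ C * (‖ξ‖ ^ 2 * ‖cut (W i) ζ‖ ^ 2) := by
  simp_rw [inner_pull_cut_pull hcomm hW]
  simpa only [norm_pull] using hT ξ (pull (e i)⁻¹ (cut (W i) ζ))

lemma GramBound.offDiag_le (hT : GramBound T C) (hcomm : ∀ a i, T a * e i = e i * T a)
    (hW : ∀ a i, T a ⁻¹' W i = W i) {i j : ι} (hij : Disjoint (W i) (W j)) (ξ η : H X) :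
    ∑ a, ∑ b, ‖⟪pull (T a) (pull (e i) ξ), pull (T b) (pull (e j) η)⟫_ℂ‖ ^ 2
      ≤ 3 * C * (‖ξ‖ ^ 2 * ‖cut (W i) (cut (W j)ᶜ (pull (e j) η))‖ ^ 2
        + ‖cut (W j) (cut (W i)ᶜ (pull (e i) ξ))‖ ^ 2 * ‖η‖ ^ 2
        + ‖cut (W i)ᶜ (pull (e i) ξ)‖ ^ 2 * ‖cut (W j)ᶜ (pull (e j) η)‖ ^ 2) := by
  set ξ' := cut (W i)ᶜ (pull (e i) ξ)
  set η' := cut (W j)ᶜ (pull (e j) η)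
  have h₁ := hT.sum_cut_le hcomm hW i ξ η'
  have h₂ : ∑ a, ∑ b, ‖⟪pull (T a) ξ', pull (T b) (cut (W j) (pull (e j) η))⟫_ℂ‖ ^ 2
      ≤ C * (‖η‖ ^ 2 * ‖cut (W j) ξ'‖ ^ 2) := by
    rw [Finset.sum_comm]
    simp_rw [norm_inner_symm (pull (T _) ξ')]
    exact hT.sum_cut_le hcomm hW j η ξ'
  have h₃ := hT ξ' η'
  have key : ∀ a b, ‖⟪pull (T a) (pull (e i) ξ), pull (T b) (pull (e j) η)⟫_ℂ‖ ^ 2 ≤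
      3 * (‖⟪pull (T a) (cut (W i) (pull (e i) ξ)), pull (T b) η'⟫_ℂ‖ ^ 2
        + ‖⟪pull (T a) ξ', pull (T b) (cut (W j) (pull (e j) η))⟫_ℂ‖ ^ 2
        + ‖⟪pull (T a) ξ', pull (T b) η'⟫_ℂ‖ ^ 2) := by
    intro a b
    have h0 : ⟪pull (T a) (cut (W i) (pull (e i) ξ)),
        pull (T b) (cut (W j) (pull (e j) η))⟫_ℂ = 0 := by
      rw [pull_cut, pull_cut, hW, hW, inner_cut_cut_of_disjoint hij]
    have hsplit : ⟪pull (T a) (pull (e i) ξ), pull (T b) (pull (e j) η)⟫_ℂ =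
        ⟪pull (T a) (cut (W i) (pull (e i) ξ)), pull (T b) η'⟫_ℂ
        + ⟪pull (T a) ξ', pull (T b) (cut (W j) (pull (e j) η))⟫_ℂ
        + ⟪pull (T a) ξ', pull (T b) η'⟫_ℂ := by
      conv_lhs => rw [← cut_add_cut_compl (W i) (pull (e i) ξ),
        ← cut_add_cut_compl (W j) (pull (e j) η)]
      simp only [map_add, inner_add_left, inner_add_right, h0]
      ring
    rw [hsplit]
    exact norm_add_three_sq_le _ _ _
  refine (Finset.sum_le_sum fun a _ => Finset.sum_le_sum fun b _ => key a b).trans ?_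
  simp only [← Finset.mul_sum, Finset.sum_add_distrib]
  linarith

lemma GramBound.mul [Fintype ι] (hC : 0 ≤ C) (hT : GramBound T C)
    (hcomm : ∀ a i, T a * e i = e i * T a) (hW : ∀ a i, T a ⁻¹' W i = W i)
    (hdisj : Pairwise (Function.onFun Disjoint W))
    (hdisj' : Pairwise (Function.onFun Disjoint fun i => (e i).symm ⁻¹' (W i)ᶜ)) :
    GramBound (fun p : ι × α => e p.1 * T p.2) ((Fintype.card ι + 9) * C) := by
  classical
  intro ξ η
  set x' : ι → H X := fun i => cut (W i)ᶜ (pull (e i) ξ)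
  set y' : ι → H X := fun i => cut (W i)ᶜ (pull (e i) η)
  have hcompl : ∀ ζ : H X, ∑ i, ‖cut (W i)ᶜ (pull (e i) ζ)‖ ^ 2 ≤ ‖ζ‖ ^ 2 := fun ζ => by
    simp only [cut_pull, norm_pull]
    exact sum_norm_sq_cut_le hdisj' ζ
  have hb : ∀ i j, ∑ a, ∑ b, ‖⟪pull (T a) (pull (e i) ξ), pull (T b) (pull (e j) η)⟫_ℂ‖ ^ 2
      ≤ (if i = j then C * (‖ξ‖ ^ 2 * ‖η‖ ^ 2) else 0)
        + 3 * C * (‖ξ‖ ^ 2 * ‖cut (W i) (y' j)‖ ^ 2 + ‖cut (W j) (x' i)‖ ^ 2 * ‖η‖ ^ 2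
          + ‖x' i‖ ^ 2 * ‖y' j‖ ^ 2) := by
    intro i j
    by_cases hij : i = j
    · subst hij
      have hdiag : ∀ a b, ⟪pull (T a) (pull (e i) ξ), pull (T b) (pull (e i) η)⟫_ℂ
          = ⟪pull (T a) ξ, pull (T b) η⟫_ℂ := fun a b => by
        rw [← pull_mul, ← pull_mul, ← hcomm, ← hcomm, pull_mul, pull_mul, inner_pull_pull]
      simp_rw [hdiag, if_true]
      exact (hT ξ η).trans (le_add_of_nonneg_right (by positivity))
    · rw [if_neg hij, zero_add]
      exact hT.offDiag_le hcomm hW (hdisj hij) ξ η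
  have hsum : ∑ p : ι × α, ∑ q : ι × α,
      ‖⟪pull (e p.1 * T p.2) ξ, pull (e q.1 * T q.2) η⟫_ℂ‖ ^ 2
      = ∑ i, ∑ j, ∑ a, ∑ b,
        ‖⟪pull (T a) (pull (e i) ξ), pull (T b) (pull (e j) η)⟫_ℂ‖ ^ 2 := by
    simp only [Fintype.sum_prod_type, pull_mul]
    exact Finset.sum_congr rfl fun i _ => Finset.sum_comm
  have h₁ : ∑ i, ∑ j, ‖cut (W i) (y' j)‖ ^ 2 ≤ ‖η‖ ^ 2 := by
    rw [Finset.sum_comm]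
    exact (Finset.sum_le_sum fun j _ => sum_norm_sq_cut_le hdisj (y' j)).trans (hcompl η)
  have h₂ : ∑ i, ∑ j, ‖cut (W j) (x' i)‖ ^ 2 ≤ ‖ξ‖ ^ 2 :=
    (Finset.sum_le_sum fun i _ => sum_norm_sq_cut_le hdisj (x' i)).trans (hcompl ξ)
  have h₃ : (∑ i, ‖x' i‖ ^ 2) * ∑ j, ‖y' j‖ ^ 2 ≤ ‖ξ‖ ^ 2 * ‖η‖ ^ 2 :=
    mul_le_mul (hcompl ξ) (hcompl η) (Finset.sum_nonneg fun _ _ => sq_nonneg _) (sq_nonneg _)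
  rw [hsum]
  refine (Finset.sum_le_sum fun i _ => Finset.sum_le_sum fun j _ => hb i j).trans ?_
  simp only [Finset.sum_add_distrib, ← Finset.mul_sum, ← Finset.sum_mul, Finset.sum_ite_eq,
    Finset.mem_univ, if_true, Finset.sum_const, Finset.card_univ, nsmul_eq_mul]
  have h₁' := mul_le_mul_of_nonneg_left h₁ (sq_nonneg ‖ξ‖)
  have h₂' := mul_le_mul_of_nonneg_right h₂ (sq_nonneg ‖η‖)
  nlinarith [mul_le_mul_of_nonneg_left (add_le_add (add_le_add h₁' h₂') h₃) hC]

end Step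

/-- The reduced words starting with the generator `g_i`. -/
def startsWith (i : ℕ) : Set FG := {x | x.toWord.head? = some (i, true)}

lemma disjoint_startsWith {i j : ℕ} (hij : i ≠ j) : Disjoint (startsWith i) (startsWith j) := by
  refine Set.disjoint_left.2 fun x hi hj => hij ?_
  simp only [startsWith, Set.mem_ofPred_eq] at hi hj
  simpa using hi.symm.trans hj

lemma head?_toWord_gen_inv_mul {i : ℕ} {x : FG} (hx : x ∉ startsWith i) :
    ((gen i)⁻¹ * x).toWord.head? = some (i, false) := by
  have h : (gen i)⁻¹ * x = FreeGroup.mk ((i, false) :: x.toWord) := by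
    conv_lhs => rw [← FreeGroup.mk_toWord (x := x)]
    rfl
  rw [h, FreeGroup.toWord_mk, FreeGroup.reduce.cons, FreeGroup.reduce_toWord]
  simp only [startsWith, Set.mem_ofPred_eq] at hx
  cases hw : x.toWord with
  | nil => rfl
  | cons hd tl =>
    have : ¬ (i = hd.1 ∧ hd.2 = true) := by
      rintro ⟨h1, h2⟩
      apply hx
      rw [hw, List.head?_cons, h1]
      congr 1
      ext <;> simp_all
    simp [this]

variable {K : ℕ}

/-- Left multiplication by `g_i⁻¹` in the coordinate `c`. -/
def coordTranslate (c : Fin K) (i : ℕ) : Equiv.Perm (Fin K → FG) :=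
  Equiv.piCongrRight fun j => if j = c then Equiv.mulLeft (gen i)⁻¹ else 1

/-- Left multiplication by `g_{v_j}⁻¹` in each coordinate `j < k`. -/
def translate {N k : ℕ} (v : Fin k → Fin N) : Equiv.Perm (Fin K → FG) :=
  Equiv.piCongrRight fun j => if h : (j : ℕ) < k then Equiv.mulLeft (gen (v ⟨j, h⟩))⁻¹ else 1

lemma translate_apply {N : ℕ} (v : Fin K → Fin N) (x : Fin K → FG) :
    translate v x = fun j => (gen (v j))⁻¹ * x j := by
  ext j; simp [translate]

lemma translate_snoc {N k : ℕ} (hk : k < K) (v : Fin k → Fin N) (i : Fin N) :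
    (translate (Fin.snoc v i : Fin (k + 1) → Fin N) : Equiv.Perm (Fin K → FG))
      = coordTranslate ⟨k, hk⟩ i * translate v := by
  ext x j
  simp only [translate, coordTranslate, Equiv.piCongrRight_apply, Equiv.Perm.mul_apply, Pi.map_apply]
  rcases lt_trichotomy (j : ℕ) k with h | h | h
  · have h1 : j ≠ ⟨k, hk⟩ := fun e => by simp [e] at h
    simp [h, h1, Nat.lt_succ_of_lt h, Fin.snoc]
  · have h1 : j = ⟨k, hk⟩ := Fin.ext h
    simp [h1, Fin.snoc]
  · have h1 : j ≠ ⟨k, hk⟩ := fun e => by simp [e] at h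
    simp [h1, h.not_gt, Nat.not_lt.2 (Nat.succ_le_of_lt h)]

theorem gramBound_translate (N : ℕ) {k : ℕ} (hk : k ≤ K) :
    GramBound (X := Fin K → FG) (fun v : Fin k → Fin N => translate v) (((N : ℝ) + 9) ^ k) := by
  induction k with
  | zero =>
    intro ξ η
    simp only [Finset.univ_unique, Finset.sum_singleton, pow_zero, one_mul]
    refine (pow_le_pow_left₀ (norm_nonneg _) (norm_inner_le_norm _ _) 2).trans ?_
    rw [norm_pull, norm_pull, mul_pow]
  | succ k ih =>
    have hk' : k < K := hk
    have step := (ih hk'.le).mul (e := fun i : Fin N => coordTranslate ⟨k, hk'⟩ (i : ℕ))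
      (W := fun i : Fin N => {x | x ⟨k, hk'⟩ ∈ startsWith i}) (by positivity) ?_ ?_ ?_ ?_
    · have := step.comp_equiv (Fin.snocEquiv fun _ : Fin (k + 1) => Fin N).symm
      rw [Fintype.card_fin, ← pow_succ'] at this
      convert this using 2 with v
      rw [← translate_snoc hk']
      congr 1
      exact ((Fin.snocEquiv fun _ : Fin (k + 1) => Fin N).apply_symm_apply v).symm
    · intro v i
      ext x j
      simp only [translate, coordTranslate, Equiv.piCongrRight_apply, Equiv.Perm.mul_apply,
        Pi.map_apply]
      by_cases h : (j : ℕ) < k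
      · have h1 : j ≠ ⟨k, hk'⟩ := fun e => by simp [e] at h
        simp [h1]
      · simp [h]
    · intro v i
      ext x
      simp [translate]
    · intro i j hij
      exact (disjoint_startsWith fun h => hij (Fin.ext h)).preimage fun x : Fin K → FG =>
        x ⟨k, hk'⟩
    · intro i j hij
      have key : ∀ (i : Fin N) (y : Fin K → FG),
          y ∈ (coordTranslate ⟨k, hk'⟩ (i : ℕ)).symm ⁻¹' {x | x ⟨k, hk'⟩ ∈ startsWith i}ᶜ →
          (y ⟨k, hk'⟩).toWord.head? = some ((i : ℕ), false) := by
        intro i y hy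
        obtain ⟨x, rfl⟩ := (coordTranslate ⟨k, hk'⟩ (i : ℕ)).surjective y
        have hx : x ⟨k, hk'⟩ ∉ startsWith i := by simpa using hy
        simpa [coordTranslate] using head?_toWord_gen_inv_mul hx
      refine Set.disjoint_left.2 fun y hi hj => hij (Fin.ext ?_)
      simpa using (key i y hi).symm.trans (key j y hj)

end Reindex

namespace GramState

open scoped InnerProductSpace ComplexOrder

section Gram

variable {ι E : Type*} [Fintype ι] [NormedAddCommGroup E] [InnerProductSpace ℂ E]

/-- The normalized (transposed) Gram matrix of a family of vectors. -/
def gramState (u : ι → E) : Matrix ι ι ℂ :=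
  Matrix.of fun p q => (Fintype.card ι : ℂ)⁻¹ * ⟪u q, u p⟫_ℂ

lemma posSemidef_gramState (u : ι → E) : (gramState u).PosSemidef := by
  have h : gramState u = (Fintype.card ι : ℂ)⁻¹ • (Matrix.gram ℂ u).transpose := rfl
  rw [h]
  refine (Matrix.posSemidef_gram ℂ u).transpose.smul ?_
  positivity

lemma gramState_diag {u : ι → E} (hu : ∀ p, ‖u p‖ = 1) (p : ι) :
    gramState u p p = (Fintype.card ι : ℂ)⁻¹ := by
  simp [gramState, inner_self_eq_norm_sq_to_K, hu]

lemma trace_gramState [Nonempty ι] {u : ι → E} (hu : ∀ p, ‖u p‖ = 1) :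
    (gramState u).trace = 1 := by
  simp [Matrix.trace, gramState_diag hu, Finset.card_univ]

end Gram

variable {ι : Type*} [Fintype ι] [DecidableEq ι] {M : Matrix ι ι ℂ}

lemma sum_eigenvalues_eq_one (hM : M.IsHermitian) (htr : M.trace = 1) :
    ∑ i, hM.eigenvalues i = 1 := by
  have := hM.trace_eq_sum_eigenvalues
  rw [htr] at this
  exact Complex.ofReal_injective (by simpa using this.symm)

lemma sum_eigenvalues_sq (hM : M.IsHermitian) :
    ∑ i, hM.eigenvalues i ^ 2 = ∑ p, ∑ q, ‖M p q‖ ^ 2 := by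
  have h₁ : (M * M).trace = ∑ i, (hM.eigenvalues i : ℂ) ^ 2 := by
    conv_lhs => rw [hM.spectral_theorem]
    rw [← map_mul, Unitary.conjStarAlgAut_apply, Matrix.trace_mul_comm, ← mul_assoc,
      Unitary.coe_star_mul_self, one_mul, Matrix.diagonal_mul_diagonal, Matrix.trace_diagonal]
    simp [sq]
  have h₂ : (M * M).trace = ∑ p, ∑ q, (‖M p q‖ : ℂ) ^ 2 := by
    simp only [Matrix.trace, Matrix.diag, Matrix.mul_apply]
    refine Finset.sum_congr rfl fun p _ => Finset.sum_congr rfl fun q _ => ?_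
    rw [← hM.apply q p, ← Complex.mul_conj']
    rfl
  exact_mod_cast h₁.symm.trans h₂

lemma vnEntropy_nonneg (hM : M.PosSemidef) (htr : M.trace = 1) : 0 ≤ vnEntropy M := by
  rw [vnEntropy, dif_pos hM.1]
  refine Finset.sum_nonneg fun i _ => Real.negMulLog_nonneg (hM.eigenvalues_nonneg i) ?_
  rw [← sum_eigenvalues_eq_one hM.1 htr]
  exact Finset.single_le_sum (fun j _ => hM.eigenvalues_nonneg j) (Finset.mem_univ i)

/-- The tangent-line bound for the logarithm at `c`. -/
lemma log_le_log_add {c x : ℝ} (hc : 0 < c) (hx : 0 < x) :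
    Real.log x ≤ Real.log c + (x / c - 1) := by
  have := Real.log_le_sub_one_of_pos (div_pos hx hc)
  rw [Real.log_div hx.ne' hc.ne'] at this
  linarith

lemma vnEntropy_le_log_card (hM : M.PosSemidef) (htr : M.trace = 1) :
    vnEntropy M ≤ Real.log (Fintype.card ι) := by
  have hsum := sum_eigenvalues_eq_one hM.1 htr
  have hne : Nonempty ι := by
    by_contra h
    rw [not_nonempty_iff] at h
    simp at hsum
  have hn : (0 : ℝ) < Fintype.card ι := by exact_mod_cast Fintype.card_pos
  set n := (Fintype.card ι : ℝ)
  rw [vnEntropy, dif_pos hM.1]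
  have key : ∀ i, Real.negMulLog (hM.1.eigenvalues i)
      ≤ hM.1.eigenvalues i * Real.log n + (n⁻¹ - hM.1.eigenvalues i) := by
    intro i
    rcases (hM.eigenvalues_nonneg i).eq_or_lt with h | h
    · rw [← h]; simp [hn.le]
    · have := log_le_log_add hn (inv_pos.2 h)
      rw [Real.log_inv] at this
      have h2 := mul_le_mul_of_nonneg_left this h.le
      have h3 : hM.1.eigenvalues i * ((hM.1.eigenvalues i)⁻¹ / n) = n⁻¹ := by field_simp
      rw [Real.negMulLog]
      linarith
  refine (Finset.sum_le_sum fun i _ => key i).trans ?_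
  rw [Finset.sum_add_distrib, Finset.sum_sub_distrib, ← Finset.sum_mul, hsum]
  simp [Finset.card_univ, n, hn.ne']

lemma neg_log_le_vnEntropy (hM : M.PosSemidef) (htr : M.trace = 1) {C : ℝ} (hC : 0 < C)
    (h : ∑ p, ∑ q, ‖M p q‖ ^ 2 ≤ C) : -Real.log C ≤ vnEntropy M := by
  rw [← sum_eigenvalues_sq hM.1] at h
  have hsum := sum_eigenvalues_eq_one hM.1 htr
  rw [vnEntropy, dif_pos hM.1]
  have key : ∀ i, hM.1.eigenvalues i * (1 - Real.log C) - hM.1.eigenvalues i ^ 2 / C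
      ≤ Real.negMulLog (hM.1.eigenvalues i) := by
    intro i
    rcases (hM.eigenvalues_nonneg i).eq_or_lt with h | h
    · rw [← h]; simp
    · have h2 := mul_le_mul_of_nonneg_left (log_le_log_add hC h) h.le
      rw [Real.negMulLog]
      linear_combination h2
  refine le_trans ?_ (Finset.sum_le_sum fun i _ => key i)
  rw [Finset.sum_sub_distrib, ← Finset.sum_mul, ← Finset.sum_div, hsum]
  have := (div_le_one hC).2 h
  linarith

/-- If `M² = D M` with `D` diagonal, then `log M = log D` on the range of `M`. -/
lemma vnEntropy_eq_of_mul_self (hM : M.IsHermitian) (D : ι → ℝ)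
    (h : M * M = Matrix.diagonal (fun p => (D p : ℂ)) * M) :
    vnEntropy M = -∑ p, Real.log (D p) * (M p p).re := by
  set f := fun i p => hM.eigenvectorBasis i p
  have hdiag : ∀ p, (M p p).re = ∑ i, hM.eigenvalues i * ‖f i p‖ ^ 2 := by
    intro p
    have : M p p = ∑ i, (hM.eigenvalues i : ℂ) * (‖f i p‖ : ℂ) ^ 2 := by
      conv_lhs => rw [hM.spectral_theorem]
      rw [Unitary.conjStarAlgAut_apply, Matrix.mul_apply]
      refine Finset.sum_congr rfl fun i _ => ?_
      rw [Matrix.mul_diagonal, ← Complex.mul_conj']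
      simp only [Matrix.IsHermitian.eigenvectorUnitary_apply, Function.comp_apply,
        Matrix.star_apply, RCLike.star_def, f]
      rw [mul_right_comm, mul_comm]
      rfl
    rw [this]
    norm_cast
  have hnorm : ∀ i, ∑ p, ‖f i p‖ ^ 2 = 1 := by
    intro i
    rw [← EuclideanSpace.norm_sq_eq, hM.eigenvectorBasis.norm_eq_one]
    simp
  have hev : ∀ i p, hM.eigenvalues i * Real.log (hM.eigenvalues i) * ‖f i p‖ ^ 2
      = hM.eigenvalues i * Real.log (D p) * ‖f i p‖ ^ 2 := by
    intro i p
    have h1 : M.mulVec (f i) = (hM.eigenvalues i : ℂ) • f i := by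
      rw [Complex.coe_smul]; exact hM.mulVec_eigenvectorBasis i
    have h2 := congrFun (congrArg (fun A : Matrix ι ι ℂ => A.mulVec (f i)) h) p
    simp only [← Matrix.mulVec_mulVec, h1, Matrix.mulVec_smul, Matrix.mulVec_diagonal,
      Pi.smul_apply, smul_eq_mul] at h2
    by_cases hl : hM.eigenvalues i = 0
    · simp [hl]
    by_cases hf : f i p = 0
    · simp [hf]
    have h3 : (hM.eigenvalues i : ℂ) ≠ 0 := by exact_mod_cast hl
    have h4 : (hM.eigenvalues i : ℂ) = D p := by
      apply mul_right_cancel₀ (mul_ne_zero h3 hf)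
      linear_combination h2
    rw [show D p = hM.eigenvalues i by exact_mod_cast h4.symm]
  rw [vnEntropy, dif_pos hM, ← Finset.sum_neg_distrib]
  calc ∑ i, Real.negMulLog (hM.eigenvalues i)
      = ∑ i, ∑ p, -(hM.eigenvalues i * Real.log (D p) * ‖f i p‖ ^ 2) := by
        refine Finset.sum_congr rfl fun i _ => ?_
        simp_rw [← hev i]
        rw [Finset.sum_neg_distrib, ← Finset.mul_sum, hnorm, Real.negMulLog]
        ring
    _ = ∑ p, -(Real.log (D p) * (M p p).re) := by
        rw [Finset.sum_comm]
        refine Finset.sum_congr rfl fun p _ => ?_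
        rw [hdiag, Finset.mul_sum, ← Finset.sum_neg_distrib]
        exact Finset.sum_congr rfl fun i _ => by ring

variable {E : Type*} [NormedAddCommGroup E] [InnerProductSpace ℂ E]

/-- The entropy of the Gram matrix of a family of basis vectors with repetitions. -/
lemma vnEntropy_gramState_of_inner_eq {Y : Type*} [DecidableEq Y] {u : ι → E} {φ : ι → Y}
    (hu : ∀ p q, ⟪u p, u q⟫_ℂ = if φ p = φ q then 1 else 0) :
    vnEntropy (gramState u) = -∑ p, Real.log
      ((Fintype.card ι : ℝ)⁻¹ * (Finset.univ.filter fun r => φ r = φ p).card)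
        * (Fintype.card ι : ℝ)⁻¹ := by
  rw [vnEntropy_eq_of_mul_self (posSemidef_gramState u).1 (fun p => (Fintype.card ι : ℝ)⁻¹ *
    (Finset.univ.filter fun r => φ r = φ p).card)]
  · congr 1
    refine Finset.sum_congr rfl fun p _ => ?_
    congr 1
    simp only [gramState, Matrix.of_apply, hu, if_true, mul_one]
    rw [← Complex.ofReal_natCast, ← Complex.ofReal_inv, Complex.ofReal_re]
  · ext p q
    rw [Matrix.diagonal_mul, Matrix.mul_apply]
    simp only [gramState, Matrix.of_apply, hu, Finset.card_filter]
    push_cast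
    rw [Finset.mul_sum, Finset.sum_mul]
    refine Finset.sum_congr rfl fun r _ => ?_
    by_cases h1 : φ r = φ p
    · simp [h1]
    · simp [h1]

end GramState

open scoped InnerProductSpace
open Reindex GramState

/-- The point mass at the identity of `F_∞^k`. -/
def pointMass (k : ℕ) : l2 k := lp.single 2 1 (1 : ℂ)

lemma norm_pointMass (k : ℕ) : ‖pointMass k‖ = 1 := by
  rw [pointMass, lp.norm_single (by norm_num), norm_one]

lemma Gmat_eq_gramState (N k : ℕ) (ξ : l2 k) :
    Gmat N k ξ = gramState fun v : Fin k → Fin N => pull (translate v) ξ := by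
  ext v w
  simp only [Gmat, gramState, Matrix.of_apply, lp.inner_eq_tsum, pull_apply, translate_apply,
    RCLike.inner_apply, Fintype.card_pi_const, Fintype.card_fin, Nat.cast_pow]
  simp only [mul_comm]

/-- The permutation `x ↦ (g_{v_j}⁻¹ x_j g_{w_j})_j`. -/
def biTranslate {N k : ℕ} (p : (Fin k → Fin N) × (Fin k → Fin N)) : Equiv.Perm (Fin k → FG) :=
  Equiv.piCongrRight fun j =>
    (Equiv.mulLeft (gen (p.1 j))⁻¹).trans (Equiv.mulRight (gen (p.2 j)))

lemma biTranslate_apply {N k : ℕ} (p : (Fin k → Fin N) × (Fin k → Fin N)) (x : Fin k → FG) :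
    biTranslate p x = fun j => (gen (p.1 j))⁻¹ * x j * gen (p.2 j) := rfl

lemma biTranslate_symm_one {N k : ℕ} (p : (Fin k → Fin N) × (Fin k → Fin N)) :
    (biTranslate p).symm 1 = fun j => gen (p.1 j) * (gen (p.2 j))⁻¹ := by
  rw [Equiv.symm_apply_eq, biTranslate_apply]
  ext j; simp

lemma card_index (N k : ℕ) :
    Fintype.card ((Fin k → Fin N) × (Fin k → Fin N)) = N ^ (2 * k) := by
  simp [two_mul, pow_add]

lemma GhatK_eq_gramState (N k : ℕ) (ξ : l2 k) :
    GhatK N k ξ =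
      gramState fun p : (Fin k → Fin N) × (Fin k → Fin N) => pull (biTranslate p) ξ := by
  ext p q
  simp only [GhatK, gramState, Matrix.of_apply, lp.inner_eq_tsum, pull_apply, biTranslate_apply,
    RCLike.inner_apply, card_index, Nat.cast_pow]
  congr 1
  exact tsum_congr fun x => mul_comm _ _

lemma inner_pull_pointMass {k : ℕ} (e f : Equiv.Perm (Fin k → FG)) :
    ⟪pull e (pointMass k), pull f (pointMass k)⟫_ℂ = if e.symm 1 = f.symm 1 then 1 else 0 := by
  rw [inner_pull_left, ← pull_mul, pointMass, lp.inner_single_left]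
  have h : f (e⁻¹ 1) = 1 ↔ e.symm 1 = f.symm 1 := by
    rw [Equiv.eq_symm_apply]; rfl
  rw [pull_apply, lp.single_apply, Pi.single_apply, Equiv.Perm.mul_apply]
  simp only [h]
  split_ifs <;> simp

section Bounds

variable {N k : ℕ}

/-- The number of coordinates where the two tuples agree. -/
def agreement (p : (Fin k → Fin N) × (Fin k → Fin N)) : ℕ := Fintype.card {c // p.1 c = p.2 c}

lemma pow_agreement_le_card (p : (Fin k → Fin N) × (Fin k → Fin N)) :
    N ^ agreement p ≤ (Finset.univ.filter fun r : (Fin k → Fin N) × (Fin k → Fin N) =>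
      (biTranslate r).symm 1 = (biTranslate p).symm 1).card := by
  let F : ({c // p.1 c = p.2 c} → Fin N) → (Fin k → Fin N) × (Fin k → Fin N) := fun f =>
    (fun c => if h : p.1 c = p.2 c then f ⟨c, h⟩ else p.1 c,
      fun c => if h : p.1 c = p.2 c then f ⟨c, h⟩ else p.2 c)
  have hF : Function.Injective F := by
    intro f f' hff
    ext ⟨c, hc⟩
    have := congrFun (congrArg Prod.fst hff) c
    simp only [F, dif_pos hc] at this
    rw [this]
  have hcard : Fintype.card ({c // p.1 c = p.2 c} → Fin N) = N ^ agreement p := by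
    rw [Fintype.card_fun, Fintype.card_fin, agreement]
  rw [← hcard, ← Finset.card_univ, ← Finset.card_image_of_injective _ hF]
  refine Finset.card_le_card fun r hr => ?_
  obtain ⟨f, -, rfl⟩ := Finset.mem_image.1 hr
  rw [Finset.mem_filter]
  refine ⟨Finset.mem_univ _, ?_⟩
  rw [biTranslate_symm_one, biTranslate_symm_one]
  ext c
  by_cases hc : p.1 c = p.2 c <;> simp [F, hc]

variable [NeZero N] {ξ : l2 k}

lemma vnEntropy_GhatK_nonneg (hξ : ‖ξ‖ = 1) : 0 ≤ vnEntropy (GhatK N k ξ) := by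
  rw [GhatK_eq_gramState]
  exact vnEntropy_nonneg (posSemidef_gramState _)
    (trace_gramState fun p => by rw [norm_pull, hξ])

lemma vnEntropy_Gmat_nonneg (hξ : ‖ξ‖ = 1) : 0 ≤ vnEntropy (Gmat N k ξ) := by
  rw [Gmat_eq_gramState]
  exact vnEntropy_nonneg (posSemidef_gramState _)
    (trace_gramState fun p => by rw [norm_pull, hξ])

lemma vnEntropy_Gmat_le (hξ : ‖ξ‖ = 1) : vnEntropy (Gmat N k ξ) ≤ k * Real.log N := by
  rw [Gmat_eq_gramState]
  refine (vnEntropy_le_log_card (posSemidef_gramState _)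
    (trace_gramState fun p => by rw [norm_pull, hξ])).trans_eq ?_
  simp

lemma le_vnEntropy_Gmat (hξ : ‖ξ‖ = 1) :
    k * (Real.log N - 9 / N) ≤ vnEntropy (Gmat N k ξ) := by
  have hN : (0 : ℝ) < N := by exact_mod_cast NeZero.pos N
  have hbound : ∑ v, ∑ w, ‖gramState (fun v : Fin k → Fin N => pull (translate v) ξ) v w‖ ^ 2
      ≤ (((N : ℝ) + 9) / N ^ 2) ^ k := by
    have h := gramBound_translate N le_rfl ξ ξ
    rw [hξ, Finset.sum_comm] at h
    simp only [gramState, Matrix.of_apply, norm_mul, mul_pow, ← Finset.mul_sum]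
    refine (mul_le_mul_of_nonneg_left h (by positivity)).trans_eq ?_
    simp only [Fintype.card_pi_const, Fintype.card_fin, norm_inv, RCLike.norm_natCast]
    push_cast
    rw [div_pow, inv_pow, ← pow_mul, ← pow_mul, mul_comm k 2]
    ring
  rw [Gmat_eq_gramState]
  refine le_trans ?_ (neg_log_le_vnEntropy (posSemidef_gramState _)
    (trace_gramState fun p => by rw [norm_pull, hξ]) (by positivity) hbound)
  have h9 : Real.log ((N + 9) / N) ≤ 9 / N := by
    refine (Real.log_le_sub_one_of_pos (by positivity)).trans_eq ?_
    field_simp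
    ring
  rw [Real.log_div (by positivity) hN.ne'] at h9
  rw [Real.log_pow, Real.log_div (by positivity) (by positivity), Real.log_pow, ← mul_neg]
  refine mul_le_mul_of_nonneg_left ?_ k.cast_nonneg
  push_cast
  linarith

lemma sum_agreement :
    (∑ p : (Fin k → Fin N) × (Fin k → Fin N), (agreement p : ℝ)) = k * N ^ (2 * k) / N := by
  have hN : (N : ℝ) ≠ 0 := by exact_mod_cast NeZero.ne N
  have h : ∀ (c : Fin k) (v : Fin k → Fin N),
      (Finset.univ.filter fun w : Fin k → Fin N => v c = w c).card = N ^ (k - 1) := by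
    intro c v
    have := Fintype.card_filter_piFinset_const_eq_of_mem (Finset.univ : Finset (Fin N)) c
      (Finset.mem_univ (v c))
    simpa [Fintype.piFinset_univ, eq_comm] using this
  have hsum : ∑ p : (Fin k → Fin N) × (Fin k → Fin N), agreement p = k * (N ^ k * N ^ (k - 1)) := by
    have hv : ∀ v : Fin k → Fin N, ∑ w, agreement (v, w) = k * N ^ (k - 1) := by
      intro v
      simp only [agreement, Fintype.card_subtype, Finset.card_filter]
      rw [Finset.sum_comm]
      simp [h]
    rw [Fintype.sum_prod_type]
    simp [hv, mul_left_comm]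
  rw [← Nat.cast_sum, hsum]
  cases k with
  | zero => simp
  | succ m =>
    push_cast
    field_simp
    ring

lemma vnEntropy_GhatK_pointMass_le :
    vnEntropy (GhatK N k (pointMass k)) ≤ k * (2 * Real.log N - Real.log N / N) := by
  have hN : (0 : ℝ) < N := by exact_mod_cast NeZero.pos N
  have hn : (0 : ℝ) < (N : ℝ) ^ (2 * k) := by positivity
  rw [GhatK_eq_gramState, vnEntropy_gramState_of_inner_eq fun p q =>
    inner_pull_pointMass (biTranslate p) (biTranslate q), card_index, ← Finset.sum_neg_distrib]
  push_cast
  have key : ∀ p : (Fin k → Fin N) × (Fin k → Fin N),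
      -(Real.log (((N : ℝ) ^ (2 * k))⁻¹ *
        (Finset.univ.filter fun r : (Fin k → Fin N) × (Fin k → Fin N) =>
          (biTranslate r).symm 1 = (biTranslate p).symm 1).card) * ((N : ℝ) ^ (2 * k))⁻¹)
      ≤ (2 * k * Real.log N - agreement p * Real.log N) * ((N : ℝ) ^ (2 * k))⁻¹ := by
    intro p
    rw [← neg_mul]
    refine mul_le_mul_of_nonneg_right ?_ (inv_pos.2 hn).le
    have h1 : ((N : ℝ) ^ agreement p) ≤ ((Finset.univ.filter
        fun r : (Fin k → Fin N) × (Fin k → Fin N) =>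
          (biTranslate r).symm 1 = (biTranslate p).symm 1).card : ℝ) := by
      exact_mod_cast pow_agreement_le_card p
    have h2 := Real.log_le_log (by positivity) h1
    rw [Real.log_mul (inv_pos.2 hn).ne' (lt_of_lt_of_le (by positivity) h1).ne', Real.log_inv,
      Real.log_pow]
    rw [Real.log_pow] at h2
    push_cast
    linarith
  refine (Finset.sum_le_sum fun p _ => key p).trans_eq ?_
  rw [← Finset.sum_mul, Finset.sum_sub_distrib,
    ← Finset.sum_mul _ (fun p => (agreement p : ℝ)), sum_agreement, Finset.sum_const,
    Finset.card_univ, card_index, nsmul_eq_mul]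
  push_cast
  field_simp

lemma A_nonneg : 0 ≤ A N k := by
  refine Real.sInf_nonneg ?_
  rintro _ ⟨ξ, hξ, rfl⟩
  exact vnEntropy_GhatK_nonneg hξ

lemma A_le : A N k ≤ k * (2 * Real.log N - Real.log N / N) := by
  have hbdd : BddBelow {x : ℝ | ∃ ξ : l2 k, ‖ξ‖ = 1 ∧ x = vnEntropy (GhatK N k ξ)} := by
    refine ⟨0, ?_⟩
    rintro _ ⟨ξ, hξ, rfl⟩
    exact vnEntropy_GhatK_nonneg hξ
  exact (csInf_le hbdd ⟨pointMass k, norm_pointMass k, rfl⟩).trans vnEntropy_GhatK_pointMass_le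

lemma le_B : k * (Real.log N - 9 / N) ≤ B N k := by
  refine le_csInf ⟨_, pointMass k, norm_pointMass k, rfl⟩ ?_
  rintro _ ⟨ξ, hξ, rfl⟩
  exact le_vnEntropy_Gmat hξ

lemma B_le : B N k ≤ k * Real.log N := by
  have hbdd : BddBelow {x : ℝ | ∃ ξ : l2 k, ‖ξ‖ = 1 ∧ x = vnEntropy (Gmat N k ξ)} := by
    refine ⟨0, ?_⟩
    rintro _ ⟨ξ, hξ, rfl⟩
    exact vnEntropy_Gmat_nonneg hξ
  exact (csInf_le hbdd ⟨pointMass k, norm_pointMass k, rfl⟩).trans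
    (vnEntropy_Gmat_le (norm_pointMass k))

end Bounds

/-- Additivity violation of the regularized minimum output entropy: for `N > e^{18}`,
`H̄_min(Φ_{N,l} ∘ Φ_{N,r}) < H̄_min(Φ_{N,l}) + H̄_min(Φ_{N,r})`, expressed as
`limsup_{k→∞} A_k/k < 2 · liminf_{k→∞} B_k/k`. -/
theorem additivity_violation_regularized_MOE (N : ℕ) (hN : Real.exp 18 < (N : ℝ)) :
    limsup (fun k : ℕ => A N k / (k : ℝ)) atTop
      < 2 * liminf (fun k : ℕ => B N k / (k : ℝ)) atTop := by
  have hN0 : (0 : ℝ) < N := (Real.exp_pos 18).trans hN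
  have : NeZero N := ⟨by rintro rfl; simp at hN0⟩
  have hlog : 18 < Real.log N := (Real.lt_log_iff_exp_lt hN0).2 hN
  have hA : limsup (fun k : ℕ => A N k / (k : ℝ)) atTop ≤ 2 * Real.log N - Real.log N / N := by
    refine limsup_le_of_le (IsCoboundedUnder.of_frequently_ge (a := 0)
      (Frequently.of_forall fun k => div_nonneg A_nonneg k.cast_nonneg)) ?_
    filter_upwards [eventually_gt_atTop 0] with k hk
    rw [div_le_iff₀' (by exact_mod_cast hk)]
    exact A_le
  have hB : Real.log N - 9 / N ≤ liminf (fun k : ℕ => B N k / (k : ℝ)) atTop := by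
    refine le_liminf_of_le (IsCoboundedUnder.of_frequently_le (a := Real.log N)
      (Eventually.frequently ?_)) ?_
    all_goals filter_upwards [eventually_gt_atTop 0] with k hk
    · rw [div_le_iff₀' (by exact_mod_cast hk)]
      exact B_le
    · rw [le_div_iff₀' (by exact_mod_cast hk)]
      exact le_B
  have h18 : 18 / (N : ℝ) < Real.log N / N := div_lt_div_of_pos_right hlog hN0
  have h9 : 2 * (9 / (N : ℝ)) = 18 / N := by ring
  linarith
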